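/- There is a K-linear isomorphism ⋀^k( ⊕_{i ∈ Fin d} M_i ) ≅ ⊕_{w} ( ⨂_{i ∈ Fin d} ⋀^{w(i)} M_i ), where the direct sum on the right runs over all functions w : Fin d → ℕ with Σ_{i} w(i) = k. (This is the decomposition, at q = 1 and after forgetting the module structure, of the k-th exterior power of the vector representation restricted to the Levi subalgebra gl_{l_1} ⊕ … ⊕ gl_{l_d}.) -/

import Mathlib

open scoped TensorProduct DirectSum

theorem stmt12_index_bij (d k : ℕ) (I : Fin d → Type*) :
    Nonempty ((Σ w : {w : Fin d → ℕ // ∑ i, w i = k}, Π i, Set.powersetCard (I i) (w.1 i)) ≃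
      Set.powersetCard (Σ i, I i) k) := by
  refine ⟨Equiv.ofBijective
    (fun p => ⟨Finset.univ.sigma (fun i => (p.2 i).1), ?_⟩) ⟨?_, ?_⟩⟩
  · change (Finset.univ.sigma (fun i => (p.2 i).1)).card = k
    rw [Finset.card_sigma]
    exact (Finset.sum_congr rfl fun i _ => (p.2 i).2).trans p.1.2
  · rintro ⟨⟨w, hw⟩, f⟩ ⟨⟨w', hw'⟩, f'⟩ h
    have h1 : Finset.univ.sigma (fun i => (f i).1) = Finset.univ.sigma (fun i => (f' i).1) :=
      congrArg Subtype.val h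
    have h2 : ∀ i, (f i).1 = (f' i).1 := by
      intro i
      ext x
      have := Finset.ext_iff.1 h1 ⟨i, x⟩
      simpa using this
    have h3 : w = w' := by
      funext i
      have a : (f i).1.card = w i := (f i).2
      have b : (f' i).1.card = w' i := (f' i).2
      rw [← a, ← b, h2]
    subst h3
    have h4 : f = f' := funext fun i => Subtype.ext (h2 i)
    subst h4
    rfl
  · rintro ⟨s, hs⟩
    classical
    have e : Finset.univ.sigma
        (fun i => s.preimage (Sigma.mk i) sigma_mk_injective.injOn) = s := by
      ext ⟨i, x⟩
      simp
    refine ⟨⟨⟨fun i => (s.preimage (Sigma.mk i) sigma_mk_injective.injOn).card, ?_⟩,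
      fun i => ⟨s.preimage (Sigma.mk i) sigma_mk_injective.injOn, rfl⟩⟩, Subtype.ext e⟩
    rw [← Finset.card_sigma, e]
    exact hs

/-- For `K`-vector spaces `M_i` (`i ∈ Fin d`) and `k : ℕ`, there is a `K`-linear isomorphism
`⋀^k(⊕_{i ∈ Fin d} M_i) ≅ ⊕_{w : Fin d → ℕ, ∑ w = k} ⨂_{i ∈ Fin d} ⋀^{w i} M_i`. -/
theorem stmt12 {K : Type*} [Field K] (d k : ℕ) (M : Fin d → Type*)
    [∀ i, AddCommGroup (M i)] [∀ i, Module K (M i)] :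
    Nonempty ((⋀[K]^k (⨁ i, M i)) ≃ₗ[K]
      ⨁ (w : {w : Fin d → ℕ // ∑ i, w i = k}), ⨂[K] (i : Fin d), ⋀[K]^(w.1 i) (M i)) := by
  classical
  let b := fun i => Module.Basis.ofVectorSpace K (M i)
  let : ∀ i, LinearOrder (Module.Basis.ofVectorSpaceIndex K (M i)) := fun i =>
    linearOrderOfSTO WellOrderingRel
  let : LinearOrder (Σ i, Module.Basis.ofVectorSpaceIndex K (M i)) :=
    linearOrderOfSTO WellOrderingRel
  let B : Module.Basis (Σ i, Module.Basis.ofVectorSpaceIndex K (M i)) K (⨁ i, M i) :=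
    DFinsupp.basis b
  let L := B.exteriorPower k
  let R : Module.Basis (Σ w : {w : Fin d → ℕ // ∑ i, w i = k},
      Π i, Set.powersetCard (Module.Basis.ofVectorSpaceIndex K (M i)) (w.1 i)) K
      (⨁ (w : {w : Fin d → ℕ // ∑ i, w i = k}), ⨂[K] (i : Fin d), ⋀[K]^(w.1 i) (M i)) :=
    DFinsupp.basis fun w => Basis.piTensorProduct fun i => (b i).exteriorPower (w.1 i)
  obtain ⟨e⟩ := stmt12_index_bij d k (fun i => Module.Basis.ofVectorSpaceIndex K (M i))
  exact ⟨L.equiv R e.symm⟩
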